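/- Let G be a finite abelian group, c : G → ℂ a function, and S, T ⊆ G. Define e_c(S,T) = Σ_{x∈S, y∈T} c(x * y⁻¹), and let λ = max over nontrivial characters χ of |ĉ(χ)| where ĉ(χ) = Σ_{g∈G} c(g) · conj(χ(g)). Then |e_c(S,T) − (1/|G|)·(Σ_{g∈G} c(g))·|S|·|T|| ≤ λ·√(|S|·|T|·(1 − |S|/|G|)·(1 − |T|/|G|)). -/

import Mathlib

section CharacterSums

open Finset ComplexConjugate

variable {G : Type*} [CommGroup G] [Fintype G]

theorem MonoidHom.finite_complexUnits : Finite (G →* ℂˣ) :=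
  have ⟨e⟩ := CommGroup.monoidHom_mulEquiv_of_hasEnoughRootsOfUnity G ℂ
  Finite.of_equiv G e.symm.toEquiv

theorem MonoidHom.conj_complexUnits_apply (χ : G →* ℂˣ) (g : G) :
    conj (χ g : ℂ) = (χ g⁻¹ : ℂˣ) := by
  have h : (χ g : ℂ) ^ Fintype.card G = 1 := by
    rw [← Units.val_pow_eq_pow_val, ← map_pow, pow_card_eq_one, map_one, Units.val_one]
  rw [map_inv, Units.val_inv_eq_inv_val,
    Complex.inv_eq_conj (Complex.norm_eq_one_of_pow_eq_one h Fintype.card_ne_zero)]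

theorem MonoidHom.sum_complexUnits_apply [Fintype (G →* ℂˣ)] [DecidableEq G] (a : G) :
    ∑ χ : G →* ℂˣ, (χ a : ℂ) = if a = 1 then (Fintype.card G : ℂ) else 0 := by
  split_ifs with ha
  · have h := CommGroup.card_monoidHom_of_hasEnoughRootsOfUnity G ℂ
    rw [Nat.card_eq_fintype_card, Nat.card_eq_fintype_card] at h
    simp [ha, h]
  · obtain ⟨φ, hφ⟩ := CommGroup.exists_apply_ne_one_of_hasEnoughRootsOfUnity G ℂ ha
    refine sum_hom_units_eq_zero ((Units.coeHom ℂ).comp (MonoidHom.eval a)) fun h ↦ hφ ?_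
    exact Units.ext (DFunLike.congr_fun h φ)

/-- Fourier expansion of the weight between two sets in a Cayley color graph. -/
theorem sum_fourier_mul_charSum_mul_conj_charSum [Fintype (G →* ℂˣ)] (c : G → ℂ)
    (S T : Finset G) :
    ∑ χ : G →* ℂˣ, (∑ g, c g * conj (χ g : ℂ)) *
        ((∑ x ∈ S, (χ x : ℂ)) * conj (∑ y ∈ T, (χ y : ℂ))) =
      Fintype.card G * ∑ x ∈ S, ∑ y ∈ T, c (x * y⁻¹) := by
  classical
  have key (x y : G) : ∑ χ : G →* ℂˣ, ∑ g, c g * conj (χ g : ℂ) * (χ x * conj (χ y : ℂ)) =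
      Fintype.card G * c (x * y⁻¹) := by
    rw [sum_comm]
    have h (g : G) : ∑ χ : G →* ℂˣ, c g * conj (χ g : ℂ) * (χ x * conj (χ y : ℂ)) =
        if x * y⁻¹ = g then c g * Fintype.card G else 0 := by
      have := MonoidHom.sum_complexUnits_apply (x * y⁻¹ * g⁻¹)
      rw [← mul_ite_zero, ← mul_inv_eq_one (a := x * y⁻¹), ← this, mul_sum]
      refine sum_congr rfl fun χ _ ↦ ?_
      simp only [MonoidHom.conj_complexUnits_apply, map_mul, Units.val_mul]
      ring
    simp_rw [h]
    simp [mul_comm]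
  simp_rw [mul_sum (s := S), mul_sum (s := T), ← key, ← sum_mul]
  rw [← sum_comm_cycle, sum_comm]
  refine sum_congr rfl fun χ _ ↦ ?_
  simp_rw [map_sum, sum_mul_sum S T, mul_sum]
  exact sum_comm

theorem sum_norm_sq_charSum [Fintype (G →* ℂˣ)] (S : Finset G) :
    ∑ χ : G →* ℂˣ, ‖∑ x ∈ S, (χ x : ℂ)‖ ^ 2 = Fintype.card G * #S := by
  classical
  have h := sum_fourier_mul_charSum_mul_conj_charSum (Pi.single 1 1) S S
  simp only [Pi.single_apply, ite_mul, one_mul, zero_mul, sum_ite_eq', mem_univ, if_true,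
    map_one, Units.val_one, Complex.mul_conj'] at h
  simp only [mul_inv_eq_one, sum_ite_eq] at h
  rw [sum_congr rfl fun x hx ↦ if_pos hx] at h
  simp only [sum_const, nsmul_eq_mul, mul_one] at h
  exact_mod_cast h

theorem sum_norm_sq_charSum_erase_one [Fintype (G →* ℂˣ)] [DecidableEq (G →* ℂˣ)]
    (S : Finset G) :
    ∑ χ ∈ (univ : Finset (G →* ℂˣ)).erase 1, ‖∑ x ∈ S, (χ x : ℂ)‖ ^ 2 =
      Fintype.card G ^ 2 * (#S / Fintype.card G * (1 - #S / Fintype.card G) : ℝ) := by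
  have h := sum_norm_sq_charSum S
  rw [← add_sum_erase _ _ (mem_univ 1)] at h
  simp only [MonoidHom.one_apply, Units.val_one, sum_const, nsmul_eq_mul, mul_one,
    Complex.norm_natCast] at h
  have hn : (Fintype.card G : ℝ) ≠ 0 := by exact_mod_cast Fintype.card_ne_zero
  rw [← eq_sub_iff_add_eq'] at h
  rw [h]
  field_simp

end CharacterSums

/-- Expander mixing lemma for abelian Cayley color graphs. -/
theorem stmt1 {G : Type*} [CommGroup G] [Fintype G] (c : G → ℂ)
    (S T : Finset G) (lam : ℝ)
    (hlam : IsGreatest {x : ℝ | ∃ χ : G →* ℂˣ, χ ≠ 1 ∧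
      x = ‖∑ g : G, c g * (starRingEnd ℂ) (χ g : ℂ)‖} lam) :
    ‖(∑ x ∈ S, ∑ y ∈ T, c (x * y⁻¹)) -
        (1 / (Fintype.card G : ℂ)) * (∑ g : G, c g) * (S.card : ℂ) * (T.card : ℂ)‖ ≤
      lam * Real.sqrt ((S.card : ℝ) * (T.card : ℝ) *
        (1 - (S.card : ℝ) / (Fintype.card G : ℝ)) *
        (1 - (T.card : ℝ) / (Fintype.card G : ℝ))) := by
  classical
  have := MonoidHom.finite_complexUnits (G := G)
  have := Fintype.ofFinite (G →* ℂˣ)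
  obtain ⟨⟨χ₀, -, hχ₀⟩, hub⟩ := hlam
  have hlam0 : 0 ≤ lam := hχ₀ ▸ norm_nonneg _
  have hn : 0 < (Fintype.card G : ℝ) := by exact_mod_cast Fintype.card_pos
  have hnC : (Fintype.card G : ℂ) ≠ 0 := by exact_mod_cast Fintype.card_ne_zero
  set n : ℝ := (Fintype.card G : ℝ)
  set E := (∑ x ∈ S, ∑ y ∈ T, c (x * y⁻¹)) -
    (1 / (Fintype.card G : ℂ)) * (∑ g : G, c g) * (S.card : ℂ) * (T.card : ℂ) with hE
  have hsum : Fintype.card G * E = ∑ χ ∈ (Finset.univ : Finset (G →* ℂˣ)).erase 1,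
      (∑ g, c g * (starRingEnd ℂ) (χ g : ℂ)) *
        ((∑ x ∈ S, (χ x : ℂ)) * (starRingEnd ℂ) (∑ y ∈ T, (χ y : ℂ))) := by
    have h := sum_fourier_mul_charSum_mul_conj_charSum c S T
    rw [← Finset.add_sum_erase _ _ (Finset.mem_univ 1)] at h
    rw [← eq_sub_iff_add_eq'] at h
    rw [h, hE, mul_sub]
    simp only [MonoidHom.one_apply, Units.val_one, map_one, mul_one, Finset.sum_const,
      nsmul_eq_mul, map_natCast]
    field_simp
  have hbound : n * ‖E‖ ≤ lam * (√(∑ χ ∈ (Finset.univ : Finset (G →* ℂˣ)).erase 1,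
      ‖∑ x ∈ S, (χ x : ℂ)‖ ^ 2) * √(∑ χ ∈ (Finset.univ : Finset (G →* ℂˣ)).erase 1,
      ‖∑ y ∈ T, (χ y : ℂ)‖ ^ 2)) := by
    calc n * ‖E‖ = ‖Fintype.card G * E‖ := by rw [norm_mul, Complex.norm_natCast]
      _ ≤ ∑ χ ∈ (Finset.univ : Finset (G →* ℂˣ)).erase 1,
          lam * (‖∑ x ∈ S, (χ x : ℂ)‖ * ‖∑ y ∈ T, (χ y : ℂ)‖) := by
        rw [hsum]
        refine norm_sum_le_of_le _ fun χ hχ ↦ ?_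
        rw [norm_mul, norm_mul, RCLike.norm_conj]
        gcongr
        exact hub ⟨χ, Finset.ne_of_mem_erase hχ, rfl⟩
      _ ≤ _ := by
        rw [← Finset.mul_sum]
        gcongr
        exact Real.sum_mul_le_sqrt_mul_sqrt _ _ _
  rw [← Real.sqrt_mul (by positivity), sum_norm_sq_charSum_erase_one,
    sum_norm_sq_charSum_erase_one] at hbound
  have hrad : n ^ 2 * (S.card / n * (1 - S.card / n)) * (n ^ 2 * (T.card / n * (1 - T.card / n))) =
      n ^ 2 * (S.card * T.card * (1 - S.card / n) * (1 - T.card / n)) := by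
    field_simp
  rw [hrad, Real.sqrt_mul (sq_nonneg n), Real.sqrt_sq hn.le, mul_left_comm] at hbound
  exact le_of_mul_le_mul_left hbound hn
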